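/- Let C be a 3-uniform clutter on [n] with F = {1,2,3} ∈ C such that for every r > 3, not all three of {1,2,r}, {1,3,r}, {2,3,r} belong to C. Let C_1 = C \ {F}, and set I = I(C̄), I_1 = I(C̄_1) in S = K[x_1,…,x_n]. Then: (i) depth(S/(I^∨ + (x_1,x_2,x_3))) ≥ depth(S/I^∨) − 1, and (ii) depth(S/I_1^∨) ≥ depth(S/I^∨). -/

import Mathlib

open MvPolynomial

noncomputable section

/-- The depth of the module `M` with respect to the ideal `J`: the supremum of the lengths
of `M`-regular sequences consisting of elements of `J`. -/
noncomputable def idealDepth {R : Type*} [CommRing R] (J : Ideal R)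
    (M : Type*) [AddCommGroup M] [Module R M] : ℕ :=
  sSup {k : ℕ | ∃ rs : List R, rs.length = k ∧ (∀ r ∈ rs, r ∈ J) ∧
    RingTheory.Sequence.IsRegular M rs}

/-- The circuit ideal of a clutter `C` on `[n]`: the ideal generated by the square-free
monomials `x_F = ∏_{i ∈ F} x_i` for the circuits `F ∈ C`. -/
noncomputable def circuitIdeal {n : ℕ} (K : Type*) [Field K]
    (C : Finset (Finset (Fin n))) : Ideal (MvPolynomial (Fin n) K) :=
  Ideal.span ((fun F => ∏ i ∈ F, (MvPolynomial.X i : MvPolynomial (Fin n) K)) '' ↑C)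

/-- The complement of a `d`-uniform clutter `C` on `[n]` inside the maximal `d`-uniform
clutter `C_{n,d}` of all `d`-subsets of `[n]`. -/
def clutterCompl {n : ℕ} (d : ℕ) (C : Finset (Finset (Fin n))) : Finset (Finset (Fin n)) :=
  Finset.powersetCard d (Finset.univ : Finset (Fin n)) \ C

/-- The Alexander dual of a square-free monomial ideal `I ⊆ K[x₁, …, xₙ]`:
the intersection of the prime ideals `P_F = (x_i : i ∈ F)` over all subsets `F ⊆ [n]`
whose square-free monomial `x_F` lies in `I` (equivalently, over the minimal generators). -/
noncomputable def alexDual {n : ℕ} {K : Type*} [Field K]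
    (I : Ideal (MvPolynomial (Fin n) K)) : Ideal (MvPolynomial (Fin n) K) :=
  ⨅ (F : Finset (Fin n)) (_ : (∏ i ∈ F, (MvPolynomial.X i : MvPolynomial (Fin n) K)) ∈ I),
    Ideal.span ((fun i => (MvPolynomial.X i : MvPolynomial (Fin n) K)) '' ↑F)


open RingTheory.Sequence CategoryTheory CategoryTheory.Abelian Module

universe u

section Depth

variable {R : Type u} [CommRing R]

theorem exists_isRegular_iff_ext [IsNoetherianRing R] {I : Ideal R} {M : Type u} [AddCommGroup M]
    [Module R M] [Module.Finite R M] (hI : I • (⊤ : Submodule R M) < ⊤) (k : ℕ) :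
    (∃ rs : List R, rs.length = k ∧ (∀ r ∈ rs, r ∈ I) ∧ IsRegular M rs) ↔
      ∀ i < k, Subsingleton
        (Ext (ModuleCat.of R (Shrink.{u} (R ⧸ I))) (ModuleCat.of R M) i) :=
  (ModuleCat.exists_isRegular_tfae I k (ModuleCat.of R M) hI).out 3 1

section ShortExact

variable {A B C : Type u} [AddCommGroup A] [AddCommGroup B] [AddCommGroup C]
  [Module R A] [Module R B] [Module R C] {f : A →ₗ[R] B} {g : B →ₗ[R] C}

theorem shortExact_of_exact (hf : Function.Injective f) (hfg : Function.Exact f g)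
    (hg : Function.Surjective g) :
    (ModuleCat.shortComplexOfCompEqZero f g hfg.linearMap_comp_eq_zero).ShortExact :=
  ModuleCat.shortComplex_shortExact _ hfg hf hg

theorem subsingleton_ext_middle (hf : Function.Injective f) (hfg : Function.Exact f g)
    (hg : Function.Surjective g) (N : ModuleCat.{u} R) (i : ℕ)
    (hA : Subsingleton (Ext N (ModuleCat.of R A) i))
    (hC : Subsingleton (Ext N (ModuleCat.of R C) i)) :
    Subsingleton (Ext N (ModuleCat.of R B) i) := by
  refine subsingleton_of_forall_eq 0 fun x => ?_
  obtain ⟨y, hy⟩ := Ext.covariant_sequence_exact₂ N (shortExact_of_exact hf hfg hg) x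
    (Subsingleton.elim (α := Ext N (ModuleCat.of R C) i) _ _)
  rw [← hy, Subsingleton.elim (α := Ext N (ModuleCat.of R A) i) y 0, Ext.zero_comp]

theorem subsingleton_ext_right (hf : Function.Injective f) (hfg : Function.Exact f g)
    (hg : Function.Surjective g) (N : ModuleCat.{u} R) (i : ℕ)
    (hA : Subsingleton (Ext N (ModuleCat.of R A) (i + 1)))
    (hB : Subsingleton (Ext N (ModuleCat.of R B) i)) :
    Subsingleton (Ext N (ModuleCat.of R C) i) := by
  refine subsingleton_of_forall_eq 0 fun x => ?_
  obtain ⟨y, hy⟩ := Ext.covariant_sequence_exact₃ N (shortExact_of_exact hf hfg hg) x rfl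
    (Subsingleton.elim (α := Ext N (ModuleCat.of R A) (i + 1)) _ _)
  rw [← hy, Subsingleton.elim (α := Ext N (ModuleCat.of R B) i) y 0, Ext.zero_comp]

end ShortExact

theorem RingTheory.Sequence.IsWeaklyRegular.supportDim_add_length_le [IsNoetherianRing R]
    {M : Type*} [AddCommGroup M] [Module R M] [Module.Finite R M] {rs : List R}
    (h : IsWeaklyRegular M rs) :
    supportDim R (M ⧸ Ideal.ofList rs • (⊤ : Submodule R M)) + rs.length ≤ supportDim R M := by
  induction rs generalizing M with
  | nil =>
    rw [Ideal.ofList_nil, Submodule.bot_smul]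
    simpa using (supportDim_eq_of_equiv (Submodule.quotEquivOfEqBot ⊥ rfl)).le
  | cons x rs ih =>
    rw [isWeaklyRegular_cons_iff] at h
    have h1 := supportDim_quotSMulTop_succ_le_of_notMem_minimalPrimes (M := M) (x := x)
      (fun _ => h.1.notMem_of_mem_minimalPrimes)
    have h2 := ih h.2
    rw [supportDim_eq_of_equiv (Submodule.quotOfListConsSMulTopEquivQuotSMulTopInner M x rs)]
    refine le_trans ?_ h1
    rw [List.length_cons, Nat.cast_add, Nat.cast_one, ← add_assoc]
    gcongr

theorem RingTheory.Sequence.IsRegular.length_le_supportDim [IsNoetherianRing R]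
    {M : Type*} [AddCommGroup M] [Module R M] [Module.Finite R M] {rs : List R}
    (h : IsRegular M rs) : (rs.length : WithBot ℕ∞) ≤ supportDim R M := by
  refine le_trans ?_ h.toIsWeaklyRegular.supportDim_add_length_le
  have := h.quot_ofList_smul_nontrivial ⊤
  have h0 : (0 : WithBot ℕ∞) ≤ supportDim R (M ⧸ Ideal.ofList rs • (⊤ : Submodule R M)) := by
    have := supportDim_ne_bot_of_nontrivial R (M ⧸ Ideal.ofList rs • (⊤ : Submodule R M))
    obtain ⟨a, ha⟩ := WithBot.ne_bot_iff_exists.mp this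
    rw [← ha]
    exact WithBot.coe_le_coe.mpr bot_le
  exact le_add_of_nonneg_left h0

theorem le_idealDepth_of_isRegular [IsNoetherianRing R] {M : Type*} [AddCommGroup M]
    [Module R M] [Module.Finite R M] {I : Ideal R} {d : ℕ} (hd : supportDim R M ≤ d)
    {rs : List R} (hI : ∀ r ∈ rs, r ∈ I) (h : IsRegular M rs) :
    rs.length ≤ idealDepth I M := by
  refine le_csSup ⟨d, ?_⟩ ⟨rs, rfl, hI, h⟩
  rintro k ⟨rs, rfl, -, h⟩
  exact_mod_cast h.length_le_supportDim.trans hd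

theorem idealDepth_le_of_forall {M : Type*} [AddCommGroup M] [Module R M] {I : Ideal R} {d : ℕ}
    (h : ∀ rs : List R, (∀ r ∈ rs, r ∈ I) → IsRegular M rs → rs.length ≤ d) :
    idealDepth I M ≤ d := by
  rcases Set.eq_empty_or_nonempty {k : ℕ | ∃ rs : List R, rs.length = k ∧ (∀ r ∈ rs, r ∈ I) ∧
    RingTheory.Sequence.IsRegular M rs} with he | hne
  · rw [idealDepth, he]; simp
  · refine csSup_le hne ?_
    rintro k ⟨rs, rfl, hI, hr⟩
    exact h rs hI hr

theorem smul_top_lt_top_of_ker_le {M : Type*} [AddCommGroup M] [Module R M] {I : Ideal R}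
    (hI : I ≠ ⊤) (g : R →ₗ[R] M) (hg : Function.Surjective g) (hgI : LinearMap.ker g ≤ I) :
    I • (⊤ : Submodule R M) < ⊤ := by
  refine lt_top_iff_ne_top.mpr fun h => hI ?_
  have h1 : g 1 ∈ I • (⊤ : Submodule R M) := by rw [h]; exact Submodule.mem_top
  have h2 : I • (⊤ : Submodule R M) ≤ Submodule.map g I := by
    rw [Submodule.smul_le]
    rintro r hr x -
    obtain ⟨x, rfl⟩ := hg x
    exact ⟨r * x, I.mul_mem_right _ hr, by rw [← smul_eq_mul, map_smul]⟩
  obtain ⟨y, hy, hy1⟩ := h2 h1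
  have : y - 1 ∈ LinearMap.ker g := by rw [LinearMap.mem_ker, map_sub, hy1, sub_self]
  rw [Ideal.eq_top_iff_one]
  simpa using I.sub_mem hy (hgI this)

theorem RingTheory.Sequence.IsWeaklyRegular.isRegular_of_smul_top_lt {M : Type*} [AddCommGroup M]
    [Module R M] {I : Ideal R} (hI : I • (⊤ : Submodule R M) < ⊤) {rs : List R}
    (h : IsWeaklyRegular M rs) (hrs : ∀ r ∈ rs, r ∈ I) : IsRegular M rs :=
  ⟨h, fun he => hI.not_ge (he.le.trans (Submodule.smul_mono_left (Ideal.span_le.mpr hrs)))⟩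

theorem RingTheory.Sequence.IsWeaklyRegular.isRegular_quotient_of_append {I : Ideal R}
    (hI : I ≠ ⊤) {l₁ l₂ : List R} (h : IsWeaklyRegular R (l₁ ++ l₂)) (h₁ : ∀ r ∈ l₁, r ∈ I)
    (h₂ : ∀ r ∈ l₂, r ∈ I) : IsRegular (R ⧸ Ideal.ofList l₁) l₂ := by
  refine IsWeaklyRegular.isRegular_of_smul_top_lt
    (smul_top_lt_top_of_ker_le hI (Submodule.mkQ (Ideal.ofList l₁)) (Submodule.mkQ_surjective _)
      ((Submodule.ker_mkQ _).le.trans (Ideal.span_le.mpr h₁))) ?_ h₂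
  have := ((isWeaklyRegular_append_iff R l₁ l₂).mp h).2
  rwa [smul_eq_mul, Ideal.mul_top] at this

theorem mem_support_quotient_iff {Q : Ideal R} {p : PrimeSpectrum R} :
    p ∈ Module.support R (R ⧸ Q) ↔ Q ≤ p.asIdeal := by
  rw [support_eq_zeroLocus, Ideal.annihilator_quotient, PrimeSpectrum.mem_zeroLocus,
    SetLike.coe_subset_coe]

theorem supportDim_quotient_le_of_forall_prime [IsNoetherianRing R] {D d : ℕ}
    (hD : ringKrullDim R ≤ D) {Q : Ideal R}
    (h : ∀ p : Ideal R, p.IsPrime → Q ≤ p →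
      ∃ l : List R, IsWeaklyRegular R l ∧ Ideal.ofList l ≤ p ∧ D ≤ d + l.length) :
    supportDim R (R ⧸ Q) ≤ d := by
  refine iSup_le fun q => ?_
  obtain ⟨l, hl, hlp, hlD⟩ := h _ q.head.1.2 (mem_support_quotient_iff.mp q.head.2)
  let q' : LTSeries (Module.support R (R ⧸ Ideal.ofList l)) :=
    { length := q.length
      toFun := fun i =>
        ⟨(q i).1, mem_support_quotient_iff.mpr (hlp.trans (LTSeries.head_le q i))⟩
      step := fun i => q.step i }
  have h1 : (q.length : WithBot ℕ∞) ≤ supportDim R (R ⧸ Ideal.ofList l) :=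
    Order.LTSeries.length_le_krullDim q'
  have h2 := hl.supportDim_add_length_le.trans ((supportDim_le_ringKrullDim R R).trans hD)
  rw [smul_eq_mul, Ideal.mul_top] at h2
  have h3 : (q.length : WithBot ℕ∞) + l.length ≤ D := (by gcongr : _ ≤ _).trans h2
  have h4 : q.length + l.length ≤ D := by exact_mod_cast h3
  exact_mod_cast (by omega : q.length ≤ d)

theorem supportDim_quotient_le_of_ringKrullDim_le {D : ℕ} (hD : ringKrullDim R ≤ D)
    (Q : Ideal R) : supportDim R (R ⧸ Q) ≤ D :=
  (supportDim_le_ringKrullDim R _).trans hD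

theorem idealDepth_quotient_top (I : Ideal R) : idealDepth I (R ⧸ (⊤ : Ideal R)) = 0 :=
  Nat.le_zero.mp <| idealDepth_le_of_forall fun _ _ h =>
    absurd h.nontrivial (not_nontrivial_iff_subsingleton.mpr inferInstance)

section Glue

variable {P J : Ideal R} {f : R}

theorem mapQ_mul_injective (hPJ : P ≤ Submodule.comap (LinearMap.mulLeft R f) J)
    (hf : ∀ p, f * p ∈ J → p ∈ P) :
    Function.Injective (Submodule.mapQ P J (LinearMap.mulLeft R f) hPJ) := by
  rw [← LinearMap.ker_eq_bot, Submodule.ker_mapQ, eq_bot_iff, Submodule.map_le_iff_le_comap,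
    Submodule.comap_bot, Submodule.ker_mkQ]
  exact hf

theorem exact_mapQ_mul_factor {Q : Ideal R}
    (hPJ : P ≤ Submodule.comap (LinearMap.mulLeft R f) J) (hJQ : J ≤ Q)
    (hQ : Q = J ⊔ Ideal.span {f}) :
    Function.Exact (Submodule.mapQ P J (LinearMap.mulLeft R f) hPJ) (Submodule.factor hJQ) := by
  subst hQ
  intro x
  obtain ⟨x, rfl⟩ := Submodule.mkQ_surjective _ x
  change Submodule.Quotient.mk x = 0 ↔ _
  rw [Submodule.Quotient.mk_eq_zero, Submodule.mem_sup, Set.mem_range, Submodule.mkQ_apply]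
  constructor
  · rintro ⟨j, hj, z, hz, rfl⟩
    obtain ⟨c, rfl⟩ := Ideal.mem_span_singleton'.mp hz
    refine ⟨Submodule.Quotient.mk c, ?_⟩
    rw [Submodule.mapQ_apply, LinearMap.mulLeft_apply, Submodule.Quotient.eq, mul_comm f c]
    simpa using hj
  · rintro ⟨y, hy⟩
    obtain ⟨y, rfl⟩ := Submodule.mkQ_surjective _ y
    rw [Submodule.mkQ_apply, Submodule.mapQ_apply, LinearMap.mulLeft_apply, eq_comm,
      Submodule.Quotient.eq] at hy
    exact ⟨_, hy, f * y, Ideal.mul_mem_right _ _ (Ideal.mem_span_singleton_self f), by ring⟩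

variable [IsNoetherianRing R] {I : Ideal R} {d D : ℕ}

theorem idealDepth_quotient_le_of_glue (hD : ringKrullDim R ≤ D) (hI : I ≠ ⊤) (hPI : P ≤ I)
    (hJI : J ≤ I) (hfJ : f ∈ J) (hJ : J ≤ P ⊔ Ideal.span {f}) (hf : ∀ p, f * p ∈ P → p ∈ P)
    (hP : ∃ rs : List R, rs.length = d ∧ (∀ r ∈ rs, r ∈ I) ∧ IsRegular (R ⧸ P) rs)
    (hd : supportDim R (R ⧸ J) ≤ d) :
    idealDepth I (R ⧸ J) - 1 ≤ idealDepth I (R ⧸ (J + P)) ∧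
      idealDepth I (R ⧸ J) ≤ idealDepth I (R ⧸ (P ⊓ J)) := by
  rw [exists_isRegular_iff_ext (smul_top_lt_top_of_ker_le hI (Submodule.mkQ P)
        (Submodule.mkQ_surjective _) ((Submodule.ker_mkQ _).le.trans hPI))] at hP
  constructor
  · rw [Nat.sub_le_iff_le_add]
    refine idealDepth_le_of_forall fun rs hrs hreg => ?_
    have hk : rs.length ≤ d := by exact_mod_cast hreg.length_le_supportDim.trans hd
    rcases Nat.eq_zero_or_pos rs.length with h0 | hpos
    · omega
    have hsup : J + P = P ⊔ Ideal.span {f} := le_antisymm (sup_le hJ le_sup_left)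
      (sup_le le_sup_right (le_sup_of_le_left ((Ideal.span_singleton_le_iff_mem _).mpr hfJ)))
    obtain ⟨ts, hlen, hts, htreg⟩ :=
      (exists_isRegular_iff_ext (smul_top_lt_top_of_ker_le hI (Submodule.mkQ (J + P))
        (Submodule.mkQ_surjective _) ((Submodule.ker_mkQ _).le.trans (sup_le hJI hPI)))
        (rs.length - 1)).mpr fun i hi =>
        subsingleton_ext_right
          (mapQ_mul_injective (f := f) (fun _ => Ideal.mul_mem_left _ _) hf)
          (exact_mapQ_mul_factor _ le_sup_right hsup) (Submodule.factor_surjective _) _ i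
          (hP (i + 1) (by omega)) (hP i (by omega))
    have := le_idealDepth_of_isRegular (supportDim_quotient_le_of_ringKrullDim_le hD (J + P))
      hts htreg
    omega
  · refine idealDepth_le_of_forall fun rs hrs hreg => ?_
    have hk : rs.length ≤ d := by exact_mod_cast hreg.length_le_supportDim.trans hd
    have hB := (exists_isRegular_iff_ext (smul_top_lt_top_of_ker_le hI (Submodule.mkQ J)
        (Submodule.mkQ_surjective _) ((Submodule.ker_mkQ _).le.trans hJI)) rs.length).mp
      ⟨rs, rfl, hrs, hreg⟩
    have hsup : J = P ⊓ J ⊔ Ideal.span {f} := by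
      have hfJ' := (Ideal.span_singleton_le_iff_mem _).mpr hfJ
      rw [inf_comm, inf_sup_assoc_of_le _ hfJ', inf_eq_left.mpr hJ]
    obtain ⟨ts, hlen, hts, htreg⟩ :=
      (exists_isRegular_iff_ext (smul_top_lt_top_of_ker_le hI (Submodule.mkQ (P ⊓ J))
        (Submodule.mkQ_surjective _) ((Submodule.ker_mkQ _).le.trans (inf_le_of_right_le hJI)))
        rs.length).mpr fun i hi =>
        subsingleton_ext_middle
          (mapQ_mul_injective (f := f) (P := P) (J := P ⊓ J)
            (fun p hp => ⟨Ideal.mul_mem_left _ _ hp, Ideal.mul_mem_right _ _ hfJ⟩)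
            fun p hp => hf p hp.1)
          (exact_mapQ_mul_factor _ inf_le_right hsup) (Submodule.factor_surjective _) _ i
          (hP i (by omega)) (hB i hi)
    exact hlen ▸ le_idealDepth_of_isRegular
      (supportDim_quotient_le_of_ringKrullDim_le hD (P ⊓ J)) hts htreg

theorem idealDepth_quotient_le_of_isWeaklyRegular_append (hD : ringKrullDim R ≤ D) (hI : I ≠ ⊤)
    {l₁ l₂ : List R} (hl : IsWeaklyRegular R (l₁ ++ l₂)) (hl₁ : Ideal.ofList l₁ = P)
    (hl₂ : ∀ r ∈ l₂, r ∈ I) (hPI : P ≤ I) (hJI : J ≤ I) (hfJ : f ∈ J)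
    (hJ : J ≤ P ⊔ Ideal.span {f}) (hf : ∀ p, f * p ∈ P → p ∈ P)
    (h : ∀ p : Ideal R, p.IsPrime → J ≤ p →
      ∃ l : List R, IsWeaklyRegular R l ∧ Ideal.ofList l ≤ p ∧ D ≤ l₂.length + l.length) :
    idealDepth I (R ⧸ J) - 1 ≤ idealDepth I (R ⧸ (J + P)) ∧
      idealDepth I (R ⧸ J) ≤ idealDepth I (R ⧸ (P ⊓ J)) := by
  subst hl₁
  exact idealDepth_quotient_le_of_glue hD hI hPI hJI hfJ hJ hf
    ⟨l₂, rfl, hl₂, hl.isRegular_quotient_of_append hI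
      (fun r hr => hPI (Ideal.subset_span hr)) hl₂⟩
    (supportDim_quotient_le_of_forall_prime hD h)

end Glue

end Depth

section VarIdeal

variable {n : ℕ} {K : Type u} [Field K]

variable (K) in
/-- The monomial prime ideal generated by the variables indexed by `s`. -/
def varIdeal (s : Set (Fin n)) : Ideal (MvPolynomial (Fin n) K) :=
  Ideal.span ((fun i => (X i : MvPolynomial (Fin n) K)) '' s)

theorem mem_varIdeal {s : Set (Fin n)} {p : MvPolynomial (Fin n) K} :
    p ∈ varIdeal K s ↔ ∀ m ∈ p.support, ∃ i ∈ s, m i ≠ 0 :=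
  mem_ideal_span_X_image

theorem varIdeal_mono {s t : Set (Fin n)} (h : s ⊆ t) : varIdeal K s ≤ varIdeal K t :=
  Ideal.span_mono (Set.image_mono h)

theorem X_mem_varIdeal {s : Set (Fin n)} {i : Fin n} (hi : i ∈ s) : X i ∈ varIdeal K s :=
  Ideal.subset_span ⟨i, hi, rfl⟩

variable (n K) in
theorem varIdeal_univ :
    varIdeal K Set.univ = Ideal.span (Set.range (X : Fin n → MvPolynomial (Fin n) K)) := by
  rw [varIdeal, Set.image_univ]

theorem varIdeal_ne_top (s : Set (Fin n)) : varIdeal K s ≠ ⊤ := by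
  rw [Ideal.ne_top_iff_one, mem_varIdeal]
  intro h
  obtain ⟨i, -, hi⟩ := h 0 (by simp)
  exact hi rfl

theorem mem_varIdeal_of_X_mul_mem {s : Set (Fin n)} {j : Fin n} (hj : j ∉ s)
    {p : MvPolynomial (Fin n) K} (h : X j * p ∈ varIdeal K s) : p ∈ varIdeal K s := by
  rw [mem_varIdeal] at h ⊢
  intro m hm
  obtain ⟨i, hi, hne⟩ := h (Finsupp.single j 1 + m) (by
    rw [MvPolynomial.mem_support_iff, coeff_X_mul]
    exact MvPolynomial.mem_support_iff.mp hm)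
  refine ⟨i, hi, ?_⟩
  have hij : j ≠ i := fun e => hj (e ▸ hi)
  simpa [Finsupp.single_apply, hij] using hne

theorem mem_varIdeal_of_prod_X_mul_mem {s : Set (Fin n)} {t : Finset (Fin n)}
    (ht : ∀ j ∈ t, j ∉ s) {p : MvPolynomial (Fin n) K}
    (h : (∏ j ∈ t, X j) * p ∈ varIdeal K s) : p ∈ varIdeal K s := by
  induction t using Finset.induction_on with
  | empty => simpa using h
  | insert a t ha ih =>
    rw [Finset.prod_insert ha, mul_assoc] at h
    exact ih (fun j hj => ht j (Finset.mem_insert_of_mem hj))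
      (mem_varIdeal_of_X_mul_mem (ht a (Finset.mem_insert_self a t)) h)

theorem prod_X_mem_varIdeal {s : Set (Fin n)} {t : Finset (Fin n)} {i : Fin n} (hs : i ∈ s)
    (ht : i ∈ t) : ∏ j ∈ t, (X j : MvPolynomial (Fin n) K) ∈ varIdeal K s :=
  Ideal.mem_of_dvd _ (Finset.dvd_prod_of_mem _ ht) (X_mem_varIdeal hs)

theorem ofList_map_X (l : List (Fin n)) :
    Ideal.ofList (l.map (X : Fin n → MvPolynomial (Fin n) K)) = varIdeal K {i | i ∈ l} := by
  rw [varIdeal, Ideal.ofList]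
  congr 1
  ext x
  simp

theorem ofList_map_X_toList (s : Finset (Fin n)) :
    Ideal.ofList (s.toList.map (X : Fin n → MvPolynomial (Fin n) K)) =
      varIdeal K (s : Set (Fin n)) := by
  rw [ofList_map_X]
  congr 1
  ext i
  simp

theorem isWeaklyRegular_map_X {l : List (Fin n)} (hl : l.Nodup) :
    IsWeaklyRegular (MvPolynomial (Fin n) K) (l.map (X : Fin n → MvPolynomial (Fin n) K)) := by
  refine ⟨fun i hi => ?_⟩
  rw [← List.map_take, smul_eq_mul, Ideal.mul_top, ofList_map_X, List.getElem_map,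
    isSMulRegular_quotient_iff_mem_of_smul_mem]
  intro p hp
  refine mem_varIdeal_of_X_mul_mem ?_ hp
  simp only [Set.mem_ofPred_eq, List.mem_take_iff_getElem]
  rintro ⟨j, hj, he⟩
  have := (hl.getElem_inj_iff).mp he
  omega

theorem alexDual_circuitIdeal (𝒢 : Finset (Finset (Fin n))) :
    alexDual (circuitIdeal K 𝒢) = ⨅ G ∈ 𝒢, varIdeal K (G : Set (Fin n)) := by
  refine le_antisymm (le_iInf₂ fun G hG => iInf₂_le G ?_)
    (le_iInf₂ fun F hF => ?_)
  · exact Ideal.subset_span (Set.mem_image_of_mem _ hG)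
  obtain ⟨G, hG, hGF⟩ : ∃ G ∈ 𝒢, G ⊆ F := by
    by_contra! hcon
    have hle : circuitIdeal K 𝒢 ≤
        RingHom.ker (eval (fun i => if i ∈ F then (1 : K) else 0)) := by
      refine Ideal.span_le.mpr ?_
      rintro _ ⟨G, hG, rfl⟩
      obtain ⟨i, hi, hiF⟩ := Finset.not_subset.mp (hcon G hG)
      simp only [SetLike.mem_coe, RingHom.mem_ker, map_prod, eval_X]
      exact Finset.prod_eq_zero hi (by simp [hiF])
    have := hle hF
    simp only [RingHom.mem_ker, map_prod, eval_X] at this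
    rw [Finset.prod_congr rfl (fun i hi => if_pos hi)] at this
    simp at this
  exact (iInf₂_le G hG).trans (varIdeal_mono (by exact_mod_cast hGF))

theorem iInf_varIdeal_le {𝒢 : Finset (Finset (Fin n))} {F : Finset (Fin n)}
    (h : ∀ r ∉ F, ∃ G ∈ 𝒢, G ⊆ insert r F) :
    ⨅ G ∈ 𝒢, varIdeal K (G : Set (Fin n)) ≤
      varIdeal K (F : Set (Fin n)) ⊔ Ideal.span {∏ r ∈ Fᶜ, X r} := by
  intro p hp
  simp only [Submodule.mem_iInf, mem_varIdeal] at hp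
  rw [p.as_sum]
  refine Ideal.sum_mem _ fun m hm => ?_
  by_cases hmF : ∃ i ∈ F, m i ≠ 0
  · refine Ideal.mem_sup_left (mem_varIdeal.mpr fun m' hm' => ?_)
    rw [Finset.mem_singleton.mp (support_monomial_subset hm')]
    exact_mod_cast hmF
  · push Not at hmF
    refine Ideal.mem_sup_right (Ideal.mem_span_singleton.mpr ?_)
    have hpos : ∀ r ∉ F, m r ≠ 0 := by
      intro r hr
      obtain ⟨G, hG, hGr⟩ := h r hr
      obtain ⟨i, hi, hne⟩ := hp G hG m hm
      rcases Finset.mem_insert.mp (hGr hi) with rfl | hiF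
      · exact hne
      · exact absurd (hmF i hiF) hne
    rw [monomial_eq]
    refine Dvd.dvd.mul_left (dvd_trans ?_ (Finset.prod_dvd_prod_of_subset Fᶜ m.support _ ?_)) _
    · exact Finset.prod_dvd_prod_of_dvd _ _ fun r hr =>
        dvd_pow_self _ (hpos r (Finset.mem_compl.mp hr))
    · exact fun r hr => Finsupp.mem_support_iff.mpr (hpos r (Finset.mem_compl.mp hr))

theorem prod_compl_mem_iInf_varIdeal {𝒢 : Finset (Finset (Fin n))} {F : Finset (Fin n)}
    (hF : ∀ G ∈ 𝒢, ¬ G ⊆ F) :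
    ∏ r ∈ Fᶜ, X r ∈ ⨅ G ∈ 𝒢, varIdeal K (G : Set (Fin n)) := by
  simp only [Submodule.mem_iInf]
  intro G hG
  obtain ⟨i, hi, hiF⟩ := Finset.not_subset.mp (hF G hG)
  exact prod_X_mem_varIdeal (Finset.mem_coe.mpr hi) (Finset.mem_compl.mpr hiF)

theorem ringKrullDim_mvPolynomial_fin_le : ringKrullDim (MvPolynomial (Fin n) K) ≤ n := by
  rw [MvPolynomial.ringKrullDim_of_isNoetherianRing, ringKrullDim_eq_zero_of_field]
  simp

theorem idealDepth_quotient_iInf_varIdeal_le {𝒢 : Finset (Finset (Fin n))} {F : Finset (Fin n)}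
    (h𝒢 : ∀ G ∈ 𝒢, G.card = F.card) (hF : F ∉ 𝒢)
    (hlocal : ∀ r ∉ F, ∃ G ∈ 𝒢, G ⊆ insert r F) :
    idealDepth (varIdeal K (Set.univ : Set (Fin n)))
        (MvPolynomial (Fin n) K ⧸ ⨅ G ∈ 𝒢, varIdeal K (G : Set (Fin n))) - 1 ≤
      idealDepth (varIdeal K (Set.univ : Set (Fin n)))
        (MvPolynomial (Fin n) K ⧸
          ((⨅ G ∈ 𝒢, varIdeal K (G : Set (Fin n))) + varIdeal K (F : Set (Fin n)))) ∧
    idealDepth (varIdeal K (Set.univ : Set (Fin n)))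
        (MvPolynomial (Fin n) K ⧸ ⨅ G ∈ 𝒢, varIdeal K (G : Set (Fin n))) ≤
      idealDepth (varIdeal K (Set.univ : Set (Fin n)))
        (MvPolynomial (Fin n) K ⧸
          (varIdeal K (F : Set (Fin n)) ⊓ ⨅ G ∈ 𝒢, varIdeal K (G : Set (Fin n)))) := by
  rcases 𝒢.eq_empty_or_nonempty with rfl | ⟨G, hG⟩
  · have h : (⨅ G ∈ (∅ : Finset (Finset (Fin n))), varIdeal K (G : Set (Fin n))) = ⊤ := by simp
    rw [h, idealDepth_quotient_top]
    exact ⟨Nat.zero_le _, Nat.zero_le _⟩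
  have hl : (F.toList ++ Fᶜ.toList).Nodup :=
    List.nodup_append'.mpr ⟨F.nodup_toList, Fᶜ.nodup_toList, by simp [List.disjoint_left]⟩
  have hreg := isWeaklyRegular_map_X (K := K) hl
  rw [List.map_append] at hreg
  refine idealDepth_quotient_le_of_isWeaklyRegular_append ringKrullDim_mvPolynomial_fin_le
    (varIdeal_ne_top _) hreg (ofList_map_X_toList F) ?_ (varIdeal_mono (Set.subset_univ _))
    ((iInf₂_le G hG).trans (varIdeal_mono (Set.subset_univ _)))
    (prod_compl_mem_iInf_varIdeal fun G hG hGF =>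
      hF (Finset.eq_of_subset_of_card_le hGF (h𝒢 G hG).ge ▸ hG))
    (iInf_varIdeal_le hlocal) (fun p => mem_varIdeal_of_prod_X_mul_mem (by simp)) ?_
  · intro r hr
    obtain ⟨i, -, rfl⟩ := List.mem_map.mp hr
    exact X_mem_varIdeal (Set.mem_univ i)
  · intro p hp hle
    rw [← Finset.inf_eq_iInf, hp.inf_le'] at hle
    obtain ⟨G, hG, hGp⟩ := hle
    refine ⟨_, isWeaklyRegular_map_X G.nodup_toList, (ofList_map_X_toList G).trans_le hGp, ?_⟩
    have hc := F.card_add_card_compl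
    rw [Fintype.card_fin] at hc
    simp only [List.length_map, Finset.length_toList, h𝒢 G hG]
    omega

end VarIdeal
theorem clutterCompl_erase {n d : ℕ} {C : Finset (Finset (Fin n))} {F : Finset (Fin n)}
    (hF : F.card = d) : clutterCompl d (C.erase F) = insert F (clutterCompl d C) := by
  ext G
  simp only [clutterCompl, Finset.mem_sdiff, Finset.mem_powersetCard_univ, Finset.mem_erase,
    Finset.mem_insert]
  by_cases h : G = F
  · simp [h, hF]
  · simp [h]

/-- Let `C` be a 3-uniform clutter on `[n]` (`n ≥ 3`, vertices `1,2,3`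
being `⟨0⟩,⟨1⟩,⟨2⟩`) with `F = {1,2,3} ∈ C` such that for every `r > 3` not all three of
`{1,2,r}, {1,3,r}, {2,3,r}` belong to `C`.  Let `C₁ = C \ {F}`, `I = I(C̄)`,
`I₁ = I(C̄₁)`.  Then
(i) `depth S/(I^∨ + (x₁,x₂,x₃)) ≥ depth S/I^∨ - 1` and
(ii) `depth S/I₁^∨ ≥ depth S/I^∨`. -/
theorem depth_dual_erase {K : Type*} [Field K] (n : ℕ) (hn : 3 ≤ n)
    (C : Finset (Finset (Fin n))) (hunif : ∀ F ∈ C, F.card = 3)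
    (hF : ({⟨0, by omega⟩, ⟨1, by omega⟩, ⟨2, by omega⟩} : Finset (Fin n)) ∈ C)
    (hlocal : ∀ r : Fin n, 2 < (r : ℕ) →
      ¬ (({⟨0, by omega⟩, ⟨1, by omega⟩, r} : Finset (Fin n)) ∈ C ∧
         ({⟨0, by omega⟩, ⟨2, by omega⟩, r} : Finset (Fin n)) ∈ C ∧
         ({⟨1, by omega⟩, ⟨2, by omega⟩, r} : Finset (Fin n)) ∈ C)) :
    idealDepth (Ideal.span (Set.range (X : Fin n → MvPolynomial (Fin n) K)))
        (MvPolynomial (Fin n) K ⧸ alexDual (circuitIdeal K (clutterCompl 3 C))) - 1 ≤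
      idealDepth (Ideal.span (Set.range (X : Fin n → MvPolynomial (Fin n) K)))
        (MvPolynomial (Fin n) K ⧸ (alexDual (circuitIdeal K (clutterCompl 3 C)) +
          Ideal.span {(X (⟨0, by omega⟩ : Fin n) : MvPolynomial (Fin n) K),
            X ⟨1, by omega⟩, X ⟨2, by omega⟩})) ∧
    idealDepth (Ideal.span (Set.range (X : Fin n → MvPolynomial (Fin n) K)))
        (MvPolynomial (Fin n) K ⧸ alexDual (circuitIdeal K (clutterCompl 3 C))) ≤
      idealDepth (Ideal.span (Set.range (X : Fin n → MvPolynomial (Fin n) K)))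
        (MvPolynomial (Fin n) K ⧸ alexDual (circuitIdeal K (clutterCompl 3
          (C.erase ({⟨0, by omega⟩, ⟨1, by omega⟩, ⟨2, by omega⟩} : Finset (Fin n)))))) := by
  set F : Finset (Fin n) := {⟨0, by omega⟩, ⟨1, by omega⟩, ⟨2, by omega⟩} with hFdef
  have hcard : F.card = 3 := hunif F hF
  have hmem : ∀ r : Fin n, r ∈ F ↔ (r : ℕ) < 3 := by
    intro r
    simp only [hFdef, Finset.mem_insert, Finset.mem_singleton, Fin.ext_iff]
    omega
  have hspan : Ideal.span {(X (⟨0, by omega⟩ : Fin n) : MvPolynomial (Fin n) K),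
      X ⟨1, by omega⟩, X ⟨2, by omega⟩} = varIdeal K (F : Set (Fin n)) := by
    rw [varIdeal, hFdef]
    simp only [Finset.coe_insert, Finset.coe_singleton, Set.image_insert_eq, Set.image_singleton]
  rw [hspan, ← varIdeal_univ, clutterCompl_erase hcard, alexDual_circuitIdeal,
    alexDual_circuitIdeal, Finset.iInf_insert]
  refine idealDepth_quotient_iInf_varIdeal_le ?_ (fun h => (Finset.mem_sdiff.mp h).2 hF) ?_
  · intro G hG
    rw [hcard]
    exact (Finset.mem_powersetCard.mp (Finset.mem_sdiff.mp hG).1).2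
  · intro r hr
    have hr3 : 3 ≤ (r : ℕ) := by simpa [hmem] using hr
    have key : ∀ i j : Fin n, (i : ℕ) < j → (j : ℕ) < 3 → ({i, j, r} : Finset (Fin n)) ∉ C →
        ∃ G ∈ clutterCompl 3 C, G ⊆ insert r F := by
      intro i j hij hj hC
      refine ⟨{i, j, r}, Finset.mem_sdiff.mpr ⟨?_, hC⟩, ?_⟩
      · refine Finset.mem_powersetCard_univ.mpr
          (Finset.card_eq_three.mpr ⟨i, j, r, ?_, ?_, ?_, rfl⟩)
          <;> (rw [Ne, Fin.ext_iff]; omega)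
      · intro k hk
        simp only [Finset.mem_insert, Finset.mem_singleton] at hk
        rw [Finset.mem_insert, hmem]
        rcases hk with rfl | rfl | rfl
        · exact Or.inr (by omega)
        · exact Or.inr hj
        · exact Or.inl rfl
    by_contra hcon
    refine hlocal r hr3 ⟨?_, ?_, ?_⟩ <;> by_contra hC <;>
      exact hcon (key _ _ (by simp) (by simp) hC)
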